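/- Let n ≥ 4 and 1 < k < n−1. If n and k are both even, or if n is odd and k ≡ 2 or 3 (mod 4), then OT_{n,k} = S_n; if n is odd and k ≡ 0 or 1 (mod 4), then OT_{n,k} = A_n. -/

import Mathlib

/-- The flip of the oval track puzzle: reverses the block of the first `k`
positions (0-indexed `0,…,k-1`, i.e. tiles `1,…,k`) and fixes the rest. -/
def otFlip (n k : ℕ) : Equiv.Perm (Fin n) :=
  Function.Involutive.toPerm
    (fun i => if h : i.val < k ∧ k ≤ n then ⟨k - 1 - i.val, by omega⟩ else i)
    (by
      intro i
      dsimp only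
      by_cases h1 : i.val < k ∧ k ≤ n
      · rw [dif_pos h1]
        rw [dif_pos (show (⟨k - 1 - i.val, by omega⟩ : Fin n).val < k ∧ k ≤ n from
          ⟨by simp; omega, h1.2⟩)]
        exact Fin.ext (by simp; omega)
      · rw [dif_neg h1, dif_neg h1])

/-- The cycle on `Fin n` given (0-indexed) by a list of natural numbers. -/
def otCycle (n : ℕ) (l : List ℕ) : Equiv.Perm (Fin n) :=
  (l.filterMap (fun a => if h : a < n then some ⟨a, h⟩ else none)).formPerm

/-- Type I: preserves the parity of every tile label. -/
def TypeI (n : ℕ) (σ : Equiv.Perm (Fin n)) : Prop :=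
  ∀ i : Fin n, (σ i).val % 2 = i.val % 2

/-- Type II: reverses the parity of every tile label. -/
def TypeII (n : ℕ) (σ : Equiv.Perm (Fin n)) : Prop :=
  ∀ i : Fin n, (σ i).val % 2 ≠ i.val % 2


open Equiv MulAction
open scoped Pointwise

theorem val_otFlip {n k : ℕ} (h : k ≤ n) (i : Fin n) :
    (otFlip n k i).val = if i.val < k then k - 1 - i.val else i.val := by
  change (dite (i.val < k ∧ k ≤ n) _ _ : Fin n).val = _
  split_ifs <;> first | rfl | omega

theorem val_finRotate_inv {n : ℕ} (i : Fin n) :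
    ((finRotate n)⁻¹ i).val = if i.val = 0 then n - 1 else i.val - 1 := by
  obtain _ | n := n
  · exact i.elim0
  obtain ⟨j, rfl⟩ := (finRotate (n + 1)).surjective i
  rw [Perm.inv_def, Equiv.symm_apply_apply, coe_finRotate]
  simp only [Fin.ext_iff, Fin.val_last]
  have := j.isLt
  split_ifs <;> first | contradiction | omega

theorem val_finRotate {n : ℕ} (i : Fin n) :
    (finRotate n i).val = if i.val = n - 1 then 0 else i.val + 1 := by
  obtain _ | n := n
  · exact i.elim0
  rw [coe_finRotate]
  simp [Fin.ext_iff]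

theorem val_finRotate_pow_zero {n : ℕ} (hn : 0 < n) (j : ℕ) (hj : j < n) :
    ((finRotate n ^ j) ⟨0, hn⟩).val = j := by
  induction j with
  | zero => rfl
  | succ j ih =>
    rw [pow_succ', Perm.mul_apply, val_finRotate, ih (by omega), if_neg (by omega)]

theorem val_conj_otFlip {n k : ℕ} (h : k < n) (i : Fin n) :
    ((finRotate n * otFlip n k * (finRotate n)⁻¹) i).val =
      if 1 ≤ i.val ∧ i.val < k + 1 then k + 1 - i.val else i.val := by
  simp only [Perm.mul_apply, val_finRotate, val_otFlip h.le, val_finRotate_inv]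
  have := i.isLt
  split_ifs <;> omega

theorem val_conj_conj_otFlip {n k : ℕ} (h : k + 1 < n) (i : Fin n) :
    ((finRotate n * (finRotate n * otFlip n k * (finRotate n)⁻¹) * (finRotate n)⁻¹) i).val =
      if 2 ≤ i.val ∧ i.val < k + 2 then k + 3 - i.val else i.val := by
  rw [Perm.mul_apply, Perm.mul_apply, val_finRotate, val_conj_otFlip (by omega),
    val_finRotate_inv]
  have := i.isLt
  split_ifs <;> omega

theorem val_swap {n : ℕ} (a b i : Fin n) :
    (swap a b i).val = if i.val = a.val then b.val else if i.val = b.val then a.val else i.val := by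
  rw [swap_apply_def]
  simp only [Fin.ext_iff]
  split_ifs <;> rfl

/-- A product of four translates of the flip is the 3-cycle `(0, k + 1, k - 1)`. -/
theorem flip_word_eq {n k : ℕ} (hk : 1 < k) (h : k + 1 < n) :
    (finRotate n * otFlip n k * (finRotate n)⁻¹) *
      (finRotate n * (finRotate n * otFlip n k * (finRotate n)⁻¹) * (finRotate n)⁻¹) *
      (finRotate n * otFlip n k * (finRotate n)⁻¹) * otFlip n k =
    swap ⟨0, by omega⟩ ⟨k - 1, by omega⟩ * swap ⟨0, by omega⟩ ⟨k + 1, h⟩ := by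
  ext i
  rw [Perm.mul_apply, Perm.mul_apply _ (_ * _ * _), Perm.mul_apply _ (_ * _ * _),
    Perm.mul_apply (swap _ _), val_conj_otFlip (by omega), val_conj_conj_otFlip h, val_conj_otFlip (by omega), val_otFlip (by omega), val_swap, val_swap]
  have := i.isLt
  dsimp only
  generalize i.val = m at *
  by_cases h0 : m = 0
  · subst h0; split_ifs <;> first | contradiction | omega
  by_cases h1 : m = k - 1
  · subst h1; split_ifs <;> first | contradiction | omega
  by_cases h2 : m = k
  · subst h2; split_ifs <;> omega
  by_cases h3 : m < k
  · simp only [h3, if_true]; split_ifs <;> omega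
  · simp only [h3, if_false]; split_ifs <;> omega

theorem otFlip_add_two {n k : ℕ} (h : k + 2 ≤ n) :
    otFlip n (k + 2) = (finRotate n * otFlip n k * (finRotate n)⁻¹) *
      swap ⟨0, by omega⟩ ⟨k + 1, by omega⟩ := by
  ext i
  rw [Perm.mul_apply, val_conj_otFlip (by omega), val_otFlip h, val_swap]
  dsimp only
  split_ifs <;> omega

theorem sign_otFlip {n : ℕ} (k : ℕ) (h : k ≤ n) :
    Perm.sign (otFlip n k) = if k % 4 = 0 ∨ k % 4 = 1 then 1 else -1 := by
  induction k using Nat.twoStepInduction with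
  | zero =>
    have : otFlip n 0 = 1 := by ext i; simp [val_otFlip h]
    simp [this]
  | one =>
    have : otFlip n 1 = 1 := by
      ext i
      rw [val_otFlip h, Perm.one_apply]
      split_ifs <;> omega
    simp [this]
  | more k ih _ =>
    rw [otFlip_add_two h, map_mul, map_mul, map_mul, map_inv, ih (by omega),
      Perm.sign_swap (by simp [Fin.ext_iff]), mul_inv_cancel_comm]
    split_ifs <;> first | rfl | omega

section

variable {n k : ℕ}

theorem finRotate_mem_closure : finRotate n ∈ Subgroup.closure {finRotate n, otFlip n k} :=
  Subgroup.subset_closure (by simp)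

theorem otFlip_mem_closure : otFlip n k ∈ Subgroup.closure {finRotate n, otFlip n k} :=
  Subgroup.subset_closure (by simp)

theorem threeCycle_mem_closure (hk : 1 < k) (h : k + 1 < n) :
    swap ⟨0, by omega⟩ ⟨k - 1, by omega⟩ * swap ⟨0, by omega⟩ ⟨k + 1, h⟩ ∈
      Subgroup.closure {finRotate n, otFlip n k} := by
  rw [← flip_word_eq hk h]
  have ht := finRotate_mem_closure (n := n) (k := k)
  have hf := otFlip_mem_closure (n := n) (k := k)
  have h1 := mul_mem (mul_mem ht hf) (inv_mem ht)
  exact mul_mem (mul_mem (mul_mem h1 (mul_mem (mul_mem ht h1) (inv_mem ht))) h1) hf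

end

theorem mem_of_pow_mem {G : Type*} [Group G] {S : Subgroup G} {g : G} {n k : ℕ} (hk : 0 < k)
    (hg : g ^ n = 1) (h1 : g ^ (k + 1) ∈ S) (h2 : g ^ (k - 1) ∈ S) (hnk : Odd n ∨ Even k) :
    g ∈ S := by
  have hsq : g ^ 2 ∈ S := by
    have : g ^ (k + 1) = g ^ 2 * g ^ (k - 1) := by rw [← pow_add]; congr 1; omega
    exact (S.mul_mem_cancel_right h2).1 (this ▸ h1)
  have hodd : ∀ m, g ^ (2 * m + 1) ∈ S → g ∈ S := fun m hm => by
    rw [pow_succ', pow_mul] at hm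
    exact (S.mul_mem_cancel_right (pow_mem hsq m)).1 hm
  obtain ⟨m, rfl⟩ | ⟨m, rfl⟩ := hnk
  · exact hodd m (hg ▸ S.one_mem)
  · exact hodd m (two_mul m ▸ h1)

theorem finRotate_pow_self (n : ℕ) : finRotate n ^ n = 1 := by
  obtain _ | n := n
  · rfl
  ext i
  have h : finRotate (n + 1) = Equiv.addRight (1 : Fin (n + 1)) :=
    Equiv.ext fun i => by simp [finRotate_apply]
  have := card_nsmul_eq_zero' (x := (1 : Fin (n + 1)))
  rw [Nat.card_fin] at this
  simp [h, this]

theorem isPreprimitive_closure {n k : ℕ} (hk : 1 < k) (h : k + 1 < n) (hnk : Odd n ∨ Even k) :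
    IsPreprimitive (Subgroup.closure {finRotate n, otFlip n k}) (Fin n) := by
  have hn : 0 < n := by omega
  set G := Subgroup.closure {finRotate n, otFlip n k}
  let t : G := ⟨finRotate n, finRotate_mem_closure⟩
  have ht : ∀ (j : ℕ) (hj : j < n), t ^ j • (⟨0, hn⟩ : Fin n) = ⟨j, hj⟩ := fun j hj =>
    Fin.ext (val_finRotate_pow_zero hn j hj)
  have htn : t ^ n = 1 := Subtype.ext (finRotate_pow_self n)
  have : IsPretransitive G (Fin n) :=
    (isPretransitive_iff_base ⟨0, hn⟩).2 fun j => ⟨t ^ j.val, ht j j.isLt⟩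
  refine .of_isTrivialBlock_base ⟨0, hn⟩ fun {B} h0 hB => ?_
  refine or_iff_not_imp_left.2 fun hns => ?_
  obtain ⟨b, hb, hb0⟩ := (Set.not_subsingleton_iff.1 hns).exists_ne ⟨0, hn⟩
  let x : G := ⟨_, threeCycle_mem_closure hk h⟩
  have hx : ∀ i : Fin n, (x • i).val = if i.val = 0 then k + 1 else
      if i.val = k + 1 then k - 1 else if i.val = k - 1 then 0 else i.val := fun i => by
    change ((swap _ _ * swap _ _ : Perm (Fin n)) i).val = _
    rw [Perm.mul_apply, val_swap, val_swap]
    dsimp only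
    split_ifs <;> first | contradiction | omega
  have hx0 : x • (⟨0, hn⟩ : Fin n) = ⟨k + 1, h⟩ := Fin.ext (by rw [hx]; simp)
  have hx1 : x • (⟨k + 1, h⟩ : Fin n) = ⟨k - 1, by omega⟩ := Fin.ext (by rw [hx]; simp)
  have hx2 : x • (⟨k - 1, by omega⟩ : Fin n) = ⟨0, hn⟩ :=
    Fin.ext (by rw [hx]; dsimp only; split_ifs <;> omega)
  have hxB : x • B = B := by
    have key : ∃ c ∈ B, x • c ∈ B := by
      by_cases hb1 : b = ⟨k + 1, h⟩
      · exact ⟨_, h0, by rwa [hx0, ← hb1]⟩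
      by_cases hb2 : b = ⟨k - 1, by omega⟩
      · exact ⟨_, hb, by rwa [hb2, hx2]⟩
      · refine ⟨b, hb, ?_⟩
        have : x • b = b := Fin.ext (by
          rw [hx]
          simp only [Fin.ext_iff, ne_eq] at hb0 hb1 hb2
          simp [hb0, hb1, hb2])
        rwa [this]
    obtain ⟨c, hc, hxc⟩ := key
    exact hB.smul_eq_of_mem hc hxc
  have hxmem : ∀ i ∈ B, x • i ∈ B := fun i hi => hxB ▸ Set.smul_mem_smul_set hi
  have hB1 := hxmem _ h0
  rw [hx0] at hB1
  have hB2 := hxmem _ hB1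
  rw [hx1] at hB2
  have hS : t ∈ stabilizer G B := by
    refine mem_of_pow_mem (by omega) htn ?_ ?_ hnk
    · exact hB.smul_eq_of_mem h0 (by rwa [ht])
    · exact hB.smul_eq_of_mem h0 (by rwa [ht])
  refine Set.eq_univ_of_forall fun j => ?_
  have hj : t ^ j.val • B = B := pow_mem hS j.val
  have := Set.smul_mem_smul_set (a := t ^ j.val) h0
  rwa [hj, ht j j.isLt] at this

theorem alternatingGroup_le_closure {n k : ℕ} (hk : 1 < k) (h : k + 1 < n)
    (hnk : Odd n ∨ Even k) :
    alternatingGroup (Fin n) ≤ Subgroup.closure {finRotate n, otFlip n k} :=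
  Perm.alternatingGroup_le_of_isPreprimitive_of_isThreeCycle_mem
    (isPreprimitive_closure hk h hnk)
    (Perm.isThreeCycle_swap_mul_swap_same (by simp [Fin.ext_iff]; omega)
      (by simp [Fin.ext_iff]) (by simp [Fin.ext_iff]))
    (threeCycle_mem_closure hk h)

theorem eq_top_of_alternatingGroup_le {α : Type*} [Fintype α] [DecidableEq α]
    {G : Subgroup (Perm α)} (hG : alternatingGroup α ≤ G) {s : Perm α} (hs : s ∈ G)
    (hsign : Perm.sign s = -1) : G = ⊤ := by
  refine (Subgroup.eq_top_iff' G).2 fun g => ?_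
  obtain hg | hg := Int.units_eq_one_or (Perm.sign g)
  · exact hG (Perm.mem_alternatingGroup.2 hg)
  · exact (G.mul_mem_cancel_right hs).1 (hG (Perm.mem_alternatingGroup.2 (by simp [hg, hsign])))

theorem stmt18 (n k : ℕ) (hn : 4 ≤ n) (hk1 : 1 < k) (hk2 : k < n - 1) :
    ((Even n ∧ Even k) ∨ (Odd n ∧ (k % 4 = 2 ∨ k % 4 = 3)) →
      Subgroup.closure {finRotate n, otFlip n k} = (⊤ : Subgroup (Equiv.Perm (Fin n)))) ∧
    (Odd n ∧ (k % 4 = 0 ∨ k % 4 = 1) →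
      Subgroup.closure {finRotate n, otFlip n k} = alternatingGroup (Fin n)) := by
  have hk : k + 1 < n := by omega
  refine ⟨?_, ?_⟩
  · rintro (⟨hne, hke⟩ | ⟨hno, hk4⟩)
    · refine eq_top_of_alternatingGroup_le (alternatingGroup_le_closure hk1 hk (.inr hke))
        finRotate_mem_closure ?_
      rw [sign_finRotate, (Nat.Even.sub_odd (by omega) hne odd_one).neg_one_pow]
    · refine eq_top_of_alternatingGroup_le (alternatingGroup_le_closure hk1 hk (.inl hno))
        otFlip_mem_closure ?_
      rw [sign_otFlip k (by omega), if_neg (by omega)]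
  · rintro ⟨hno, hk4⟩
    refine le_antisymm ?_ (alternatingGroup_le_closure hk1 hk (.inl hno))
    rw [Subgroup.closure_le]
    rintro g (rfl | rfl)
    · exact Perm.mem_alternatingGroup.2 (by
        rw [sign_finRotate, (Nat.Odd.sub_odd hno odd_one).neg_one_pow])
    · exact Perm.mem_alternatingGroup.2 (by rw [sign_otFlip k (by omega), if_pos hk4])
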